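/- Assume the non-degenerate case, center separation with c ≥ 48, centers ν_1,…,ν_k ∈ ℝ^d with ‖μ_r − ν_r‖ ≤ 6·Δ_r for every r, and let Â be an n×d real matrix with ‖Â − C‖_F² ≤ 8·k·‖A − C‖². For each r let S_r = {i : ‖Â_i − ν_r‖ ≤ (1/3)·‖Â_i − ν_s‖ for every s ≠ r}. Then for every r, at most (512/c²)·n_r points of T_r do not belong to S_r. -/

import Mathlib

open Finset
open scoped Classical

noncomputable section

/-- Spectral (ℓ₂ operator) norm of a real matrix. -/
def specNorm {m p : Type*} [Fintype m] [Fintype p] [DecidableEq p] (M : Matrix m p ℝ) : ℝ :=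
  ‖LinearMap.toContinuousLinearMap (Matrix.toEuclideanLin M)‖

/-- Frobenius norm of a real matrix. -/
def frobNorm {m p : Type*} [Fintype m] [Fintype p] (M : Matrix m p ℝ) : ℝ :=
  Real.sqrt (∑ i, ∑ j, (M i j) ^ 2)

variable {n d k : ℕ}

/-- The i-th row of a matrix, viewed as a point of Euclidean space. -/
def row (M : Matrix (Fin n) (Fin d) ℝ) (i : Fin n) : EuclideanSpace ℝ (Fin d) :=
  (WithLp.equiv 2 (Fin d → ℝ)).symm (M i)

/-- The set of indices assigned to cluster `r` by the clustering `τ`. -/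
def cluster (τ : Fin n → Fin k) (r : Fin k) : Finset (Fin n) :=
  Finset.univ.filter fun i => τ i = r

/-- The size `n_r` of cluster `r`. -/
def clusterSize (τ : Fin n → Fin k) (r : Fin k) : ℕ := (cluster τ r).card

/-- The mean of the rows of `M` indexed by `S`. -/
def meanOf (M : Matrix (Fin n) (Fin d) ℝ) (S : Finset (Fin n)) : EuclideanSpace ℝ (Fin d) :=
  (S.card : ℝ)⁻¹ • ∑ i ∈ S, row M i

/-- The mean `μ_r` of cluster `r`. -/
def mu (A : Matrix (Fin n) (Fin d) ℝ) (τ : Fin n → Fin k) (r : Fin k) :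
    EuclideanSpace ℝ (Fin d) :=
  meanOf A (cluster τ r)

/-- The matrix `C` whose i-th row is the mean of the cluster containing `i`. -/
def centerMatrix (A : Matrix (Fin n) (Fin d) ℝ) (τ : Fin n → Fin k) :
    Matrix (Fin n) (Fin d) ℝ :=
  fun i j => mu A τ (τ i) j

/-- `Δ_r = (1/√n_r) · min {√k·‖A−C‖, ‖A−C‖_F}`. -/
def Delta (A : Matrix (Fin n) (Fin d) ℝ) (τ : Fin n → Fin k) (r : Fin k) : ℝ :=
  (Real.sqrt (clusterSize τ r))⁻¹ *
    min (Real.sqrt k * specNorm (A - centerMatrix A τ)) (frobNorm (A - centerMatrix A τ))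

end

/-- `S_r = {i : ‖Â_i − ν_r‖ ≤ (1/3)·‖Â_i − ν_s‖ for every s ≠ r}`. -/
noncomputable def Sset {n d k : ℕ} (Ahat : Matrix (Fin n) (Fin d) ℝ)
    (ν : Fin k → EuclideanSpace ℝ (Fin d)) (r : Fin k) : Finset (Fin n) :=
  Finset.univ.filter fun i => ∀ s, s ≠ r → ‖row Ahat i - ν r‖ ≤ (1 / 3) * ‖row Ahat i - ν s‖

theorem frobNorm_sq {m p : Type*} [Fintype m] [Fintype p] (M : Matrix m p ℝ) :
    frobNorm M ^ 2 = ∑ i, ∑ j, (M i j) ^ 2 :=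
  Real.sq_sqrt (by positivity)

theorem frobNorm_nonneg {m p : Type*} [Fintype m] [Fintype p] (M : Matrix m p ℝ) :
    0 ≤ frobNorm M :=
  Real.sqrt_nonneg _

theorem specNorm_pos {m p : Type*} [Fintype m] [Fintype p] [DecidableEq p] {M : Matrix m p ℝ}
    (hM : M ≠ 0) : 0 < specNorm M := by
  refine norm_pos_iff.2 fun h => hM ?_
  simpa using h

theorem frobNorm_sub_centerMatrix_sq {n d k : ℕ} (A M : Matrix (Fin n) (Fin d) ℝ)
    (τ : Fin n → Fin k) :
    frobNorm (M - centerMatrix A τ) ^ 2 = ∑ i, ‖row M i - mu A τ (τ i)‖ ^ 2 := by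
  rw [frobNorm_sq]
  refine Finset.sum_congr rfl fun i _ => ?_
  rw [EuclideanSpace.norm_sq_eq]
  refine Finset.sum_congr rfl fun j _ => ?_
  simp [row, centerMatrix]

theorem Delta_nonneg {n d k : ℕ} (A : Matrix (Fin n) (Fin d) ℝ) (τ : Fin n → Fin k) (r : Fin k) :
    0 ≤ Delta A τ r :=
  mul_nonneg (by positivity)
    (le_min (mul_nonneg (Real.sqrt_nonneg _) (norm_nonneg _)) (frobNorm_nonneg _))

theorem clusterSize_mul_Delta_sq {n d k : ℕ} (A : Matrix (Fin n) (Fin d) ℝ) (τ : Fin n → Fin k)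
    (hnondeg : (k : ℝ) * specNorm (A - centerMatrix A τ) ^ 2 ≤
      frobNorm (A - centerMatrix A τ) ^ 2)
    (r : Fin k) (hr : (cluster τ r).Nonempty) :
    clusterSize τ r * Delta A τ r ^ 2 = k * specNorm (A - centerMatrix A τ) ^ 2 := by
  have hn : (0 : ℝ) < clusterSize τ r := by exact_mod_cast hr.card_pos
  have hmin : Real.sqrt k * specNorm (A - centerMatrix A τ) ≤ frobNorm (A - centerMatrix A τ) := by
    refine le_of_sq_le_sq ?_ (frobNorm_nonneg _)
    rwa [mul_pow, Real.sq_sqrt (Nat.cast_nonneg k)]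
  rw [Delta, min_eq_left hmin, mul_pow, mul_pow, inv_pow, Real.sq_sqrt hn.le,
    Real.sq_sqrt (Nat.cast_nonneg k), mul_inv_cancel_left₀ hn.ne']

/-- If `x` is not three times closer to `p` than to `q`, where `p`, `q` approximate well separated
points `a`, `b`, then `x` is far from `a`. -/
theorem le_norm_sub_of_not_close {E : Type*} [SeminormedAddCommGroup E] {x a b p q : E}
    {c α β : ℝ} (hc : 48 ≤ c) (hα : 0 ≤ α) (hβ : 0 ≤ β) (hsep : c * (α + β) ≤ ‖a - b‖)
    (ha : ‖a - p‖ ≤ 6 * α) (hb : ‖b - q‖ ≤ 6 * β) (hx : 1 / 3 * ‖x - q‖ < ‖x - p‖) :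
    c / 8 * α ≤ ‖x - a‖ := by
  have h1 : ‖x - p‖ ≤ ‖x - a‖ + ‖a - p‖ := norm_sub_le_norm_sub_add_norm_sub ..
  have h2 : ‖a - b‖ ≤ ‖a - x‖ + ‖x - b‖ := norm_sub_le_norm_sub_add_norm_sub ..
  have h3 : ‖x - b‖ ≤ ‖x - q‖ + ‖q - b‖ := norm_sub_le_norm_sub_add_norm_sub ..
  rw [norm_sub_rev a x] at h2
  rw [norm_sub_rev q b] at h3
  nlinarith [mul_le_mul_of_nonneg_right hc hα, mul_le_mul_of_nonneg_right hc hβ]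

/-- in the non-degenerate case, under center separation with `c ≥ 48`, matched
centers `ν_r` with `‖μ_r − ν_r‖ ≤ 6Δ_r` and `‖Â − C‖_F² ≤ 8k‖A − C‖²`, at most `(512/c²)·n_r`
points of `T_r` do not belong to `S_r`. -/
theorem stmt12 {n d k : ℕ} (hk : 2 ≤ k) (A Ahat : Matrix (Fin n) (Fin d) ℝ)
    (τ : Fin n → Fin k) (hfib : ∀ r, (cluster τ r).Nonempty)
    (hnondeg : (k : ℝ) * specNorm (A - centerMatrix A τ) ^ 2 ≤
      frobNorm (A - centerMatrix A τ) ^ 2)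
    (c : ℝ) (hc : 48 ≤ c)
    (hAC : A ≠ centerMatrix A τ)
    (hsep : ∀ r s, r ≠ s → c * (Delta A τ r + Delta A τ s) ≤ ‖mu A τ r - mu A τ s‖)
    (ν : Fin k → EuclideanSpace ℝ (Fin d))
    (hν : ∀ r, ‖mu A τ r - ν r‖ ≤ 6 * Delta A τ r)
    (hAhat : frobNorm (Ahat - centerMatrix A τ) ^ 2 ≤ 8 * k * specNorm (A - centerMatrix A τ) ^ 2)
    (r : Fin k) :
    (((cluster τ r).filter fun i => i ∉ Sset Ahat ν r).card : ℝ) ≤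
      512 / c ^ 2 * clusterSize τ r := by
  set B := (cluster τ r).filter fun i => i ∉ Sset Ahat ν r with hB
  have hsize := clusterSize_mul_Delta_sq A τ hnondeg r (hfib r)
  have hspec := specNorm_pos (sub_ne_zero.2 hAC)
  have hΔ : 0 < Delta A τ r ^ 2 := by
    have hk0 : (0 : ℝ) < k := by exact_mod_cast (by omega : 0 < k)
    refine pos_of_mul_pos_right ?_ (Nat.cast_nonneg (clusterSize τ r))
    rw [hsize]
    positivity
  have hfar : ∀ i ∈ B, (c / 8 * Delta A τ r) ^ 2 ≤ ‖row Ahat i - mu A τ (τ i)‖ ^ 2 := by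
    intro i hi
    simp only [hB, Sset, cluster, mem_filter, mem_univ, true_and, not_forall, not_le] at hi
    obtain ⟨rfl, s, hs, hlt⟩ := hi
    have hΔ0 := Delta_nonneg A τ (τ i)
    refine pow_le_pow_left₀ (by positivity) ?_ 2
    exact le_norm_sub_of_not_close hc hΔ0 (Delta_nonneg A τ s) (hsep _ s hs.symm) (hν _) (hν s) hlt
  have hcount : B.card * (c / 8 * Delta A τ r) ^ 2 ≤ 8 * (clusterSize τ r * Delta A τ r ^ 2) := by
    calc B.card * (c / 8 * Delta A τ r) ^ 2
        = ∑ _i ∈ B, (c / 8 * Delta A τ r) ^ 2 := by simp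
      _ ≤ ∑ i ∈ B, ‖row Ahat i - mu A τ (τ i)‖ ^ 2 := Finset.sum_le_sum hfar
      _ ≤ ∑ i, ‖row Ahat i - mu A τ (τ i)‖ ^ 2 :=
        Finset.sum_le_univ_sum_of_nonneg fun i => by positivity
      _ = frobNorm (Ahat - centerMatrix A τ) ^ 2 := (frobNorm_sub_centerMatrix_sq A Ahat τ).symm
      _ ≤ 8 * (clusterSize τ r * Delta A τ r ^ 2) := by rw [hsize]; linarith
  have hc0 : 0 < c := by linarith
  rw [div_mul_eq_mul_div, le_div_iff₀ (by positivity)]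
  refine le_of_mul_le_mul_right ?_ hΔ
  linarith
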